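/- Let Λ = U³ ⊕ E8² ⊕ ⟨−2⟩ and let ι, ι′ ∈ O(Λ) be involutions whose invariant sublattices Λ^ι and Λ^{ι′} are both isometric to ⟨2⟩ ⊕ ⟨−2⟩. Let g ∈ Λ^ι and g′ ∈ Λ^{ι′} be elements of square −2 (each is unique up to sign), and suppose div_Λ(g) = div_Λ(g′) = 2. Then ι and ι′ are conjugate in O(Λ): there exists γ ∈ O(Λ) with ι′ = γ ∘ ι ∘ γ⁻¹. -/

import Mathlib

open Matrix

/-- The Gram pairing `(x, y) ↦ xᵀ G y` of an integer matrix `G`, as a bilinear map. -/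
def gramBilin {n : ℕ} (G : Matrix (Fin n) (Fin n) ℤ) :
    (Fin n → ℤ) →ₗ[ℤ] (Fin n → ℤ) →ₗ[ℤ] ℤ :=
  Matrix.toLinearMap₂' ℤ G

/-- The hyperbolic plane `U`, with Gram matrix `[[0,1],[1,0]]`. -/
def UGram : Matrix (Fin 2) (Fin 2) ℤ := !![0, 1; 1, 0]

/-- `U(2)`, with Gram matrix `[[0,2],[2,0]]`. -/
def U2Gram : Matrix (Fin 2) (Fin 2) ℤ := !![0, 2; 2, 0]

/-- `⟨2⟩ ⊕ ⟨-2⟩`. -/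
def diag2Gram : Matrix (Fin 2) (Fin 2) ℤ := !![2, 0; 0, -2]

/-- The (negative definite even unimodular) `E8` lattice: the negative of the E₈ Cartan matrix. -/
def E8Gram : Matrix (Fin 8) (Fin 8) ℤ := -CartanMatrix.E₈

/-- The rank-one lattice `⟨k⟩`. -/
def rankOneGram (k : ℤ) : Matrix (Fin 1) (Fin 1) ℤ := !![k]

/-- Orthogonal direct sum of two bilinear forms, on the product module. -/
def prodBilin {M N : Type*} [AddCommGroup M] [AddCommGroup N] [Module ℤ M] [Module ℤ N]
    (BM : M →ₗ[ℤ] M →ₗ[ℤ] ℤ) (BN : N →ₗ[ℤ] N →ₗ[ℤ] ℤ) :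
    (M × N) →ₗ[ℤ] (M × N) →ₗ[ℤ] ℤ :=
  LinearMap.mk₂ ℤ (fun x y => BM x.1 y.1 + BN x.2 y.2)
    (by intro m₁ m₂ n; simp [map_add]; ring)
    (by intro c m n; simp [_root_.map_smul, smul_eq_mul]; ring)
    (by intro m n₁ n₂; simp [map_add]; ring)
    (by intro c m n; simp [_root_.map_smul, smul_eq_mul]; ring)

/-- The underlying module of `Λ = U³ ⊕ E8² ⊕ ⟨-2⟩`. -/
abbrev LambdaM : Type :=
  (Fin 2 → ℤ) × (Fin 2 → ℤ) × (Fin 2 → ℤ) × (Fin 8 → ℤ) × (Fin 8 → ℤ) × (Fin 1 → ℤ)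

/-- The bilinear form of the Beauville–Bogomolov lattice `Λ = U³ ⊕ E8² ⊕ ⟨-2⟩`. -/
def LambdaB : LambdaM →ₗ[ℤ] LambdaM →ₗ[ℤ] ℤ :=
  prodBilin (gramBilin UGram) <| prodBilin (gramBilin UGram) <| prodBilin (gramBilin UGram) <|
    prodBilin (gramBilin E8Gram) <| prodBilin (gramBilin E8Gram) (gramBilin (rankOneGram (-2)))

/-- Membership in `O(Λ)`: a linear automorphism preserving the form. -/
def IsIsometry (f : LambdaM ≃ₗ[ℤ] LambdaM) : Prop :=
  ∀ x y, LambdaB (f x) (f y) = LambdaB x y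

/-- The invariant sublattice `Λ^ι = {x | ι x = x}`. -/
def invLattice (f : LambdaM ≃ₗ[ℤ] LambdaM) : Submodule ℤ LambdaM :=
  LinearMap.eqLocus (f : LambdaM →ₗ[ℤ] LambdaM) (LinearMap.id)

/-- A submodule of `Λ`, with the restricted form, is isometric to the lattice `(N, BN)`. -/
def IsometricTo {N : Type*} [AddCommGroup N] [Module ℤ N]
    (K : Submodule ℤ LambdaM) (BN : N →ₗ[ℤ] N →ₗ[ℤ] ℤ) : Prop :=
  ∃ e : K ≃ₗ[ℤ] N, ∀ x y : K, BN (e x) (e y) = LambdaB (x : LambdaM) (y : LambdaM)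

/-- `div_Λ(v) = d`: the ideal of values `B(v, ·)` is generated by the positive integer `d`. -/
def HasDivisibility (v : LambdaM) (d : ℤ) : Prop :=
  0 < d ∧ (∀ x, d ∣ LambdaB v x) ∧ ∃ x, LambdaB v x = d

/-- Conjugacy in `O(Λ)`: `ι' = γ ∘ ι ∘ γ⁻¹` for some isometry `γ`. -/
def ConjInO (ι ι' : LambdaM ≃ₗ[ℤ] LambdaM) : Prop :=
  ∃ γ : LambdaM ≃ₗ[ℤ] LambdaM, IsIsometry γ ∧ ∀ x, ι' x = γ (ι (γ.symm x))

/-- A sublattice has signature (1,1): rank two, containing both an element of positive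
square and an element of negative square. -/
def SigOneOne (K : Submodule ℤ LambdaM) : Prop :=
  Module.finrank ℤ K = 2 ∧ (∃ x ∈ K, 0 < LambdaB x x) ∧ (∃ x ∈ K, LambdaB x x < 0)

/-- The orthogonal complement of a submodule of `Λ`. -/
def perpOf (K : Submodule ℤ LambdaM) : Submodule ℤ LambdaM where
  carrier := {x | ∀ s ∈ K, LambdaB x s = 0}
  add_mem' := by
    intro a b ha hb s hs
    simp [map_add, LinearMap.add_apply, ha s hs, hb s hs]
  zero_mem' := by
    intro s hs
    simp
  smul_mem' := by
    intro c a ha s hs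
    simp only [_root_.map_smul, LinearMap.smul_apply, ha s hs, smul_zero]

/-- `IsTransvectionStep B w x y`: the vector `y` is the image of `x` under an Eichler transvection
`x ↦ x - B(a,x) u + B(u,x) a - (B(a,a)/2) B(u,x) u` with `u`, `a` orthogonal to `w`. -/
def IsTransvectionStep {M : Type*} [AddCommGroup M] (B : M →ₗ[ℤ] M →ₗ[ℤ] ℤ)
    (w x y : M) : Prop :=
  ∃ (u a : M) (s : ℤ), B u u = 0 ∧ B u a = 0 ∧ B u w = 0 ∧ B a w = 0 ∧ B a a = 2 * s ∧
    y = x - B a x • u + B u x • a - (s * B u x) • u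

/-- Equivalence of vectors under products of Eichler transvections fixing `w`. -/
abbrev EichlerEquiv {M : Type*} [AddCommGroup M] (B : M →ₗ[ℤ] M →ₗ[ℤ] ℤ)
    (w : M) : M → M → Prop :=
  Relation.ReflTransGen (IsTransvectionStep B w)

/-- `u`, `v` span a hyperbolic plane orthogonal to `w`. -/
structure IsHyperbolicPair {M : Type*} [AddCommGroup M] (B : M →ₗ[ℤ] M →ₗ[ℤ] ℤ)
    (w u v : M) : Prop where
  left_self : B u u = 0
  right_self : B v v = 0
  left_right : B u v = 1
  left_fixed : B u w = 0
  right_fixed : B v w = 0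

section Eichler

variable {M : Type*} [AddCommGroup M] {B : M →ₗ[ℤ] M →ₗ[ℤ] ℤ} {w : M}

theorem IsHyperbolicPair.symm (hsymm : ∀ x y, B x y = B y x) {u v : M}
    (h : IsHyperbolicPair B w u v) : IsHyperbolicPair B w v u :=
  ⟨h.right_self, h.left_self, by rw [hsymm, h.left_right], h.right_fixed, h.left_fixed⟩

theorem IsTransvectionStep.exists_isometry (hsymm : ∀ x y, B x y = B y x) {x y : M}
    (h : IsTransvectionStep B w x y) :
    ∃ γ : M ≃ₗ[ℤ] M, (∀ p q, B (γ p) (γ q) = B p q) ∧ γ w = w ∧ γ x = y := by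
  obtain ⟨u, a, s, huu, hua, huw, haw, haa, rfl⟩ := h
  have hau : B a u = 0 := by rw [hsymm, hua]
  let T : M → M →ₗ[ℤ] M := fun b =>
    LinearMap.id - (B b).smulRight u + (B u).smulRight b - (s • B u).smulRight u
  have hT : ∀ b p, T b p = p - B b p • u + B u p • b - (s * B u p) • u := by
    intro b p
    simp [T]
  refine ⟨LinearEquiv.ofLinearMap (T a) (T (-a)) ?_ ?_, ?_, ?_, ?_⟩
  · ext p
    simp only [LinearMap.comp_apply, hT, map_neg, LinearMap.neg_apply, map_sub, map_add,
      _root_.map_smul, smul_eq_mul, huu, hua, hau, haa, LinearMap.id_apply]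
    module
  · ext p
    simp only [LinearMap.comp_apply, hT, map_neg, LinearMap.neg_apply, map_sub, map_add,
      _root_.map_smul, smul_eq_mul, huu, hua, hau, haa, LinearMap.id_apply]
    module
  · intro p q
    simp only [LinearEquiv.coe_ofLinearMap, hT, map_sub, map_add, LinearMap.sub_apply,
      LinearMap.add_apply, LinearMap.smul_apply, _root_.map_smul, smul_eq_mul, huu, hua, hau, haa,
      hsymm p u, hsymm p a]
    ring
  · simp [hT, huw, haw]
  · simp [hT]

theorem EichlerEquiv.exists_isometry (hsymm : ∀ x y, B x y = B y x) {x y : M}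
    (h : EichlerEquiv B w x y) :
    ∃ γ : M ≃ₗ[ℤ] M, (∀ p q, B (γ p) (γ q) = B p q) ∧ γ w = w ∧ γ x = y := by
  induction h with
  | refl => exact ⟨LinearEquiv.refl ℤ M, fun _ _ => rfl, rfl, rfl⟩
  | tail _ hstep ih =>
    obtain ⟨γ, h₁, h₂, h₃⟩ := ih
    obtain ⟨γ', h₁', h₂', h₃'⟩ := hstep.exists_isometry hsymm
    exact ⟨γ.trans γ', fun p q => by simp [h₁, h₁'], by simp [h₂, h₂'], by simp [h₃, h₃']⟩

/-- Eichler transvections act trivially modulo `d` on vectors of divisibility `d`. -/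
theorem EichlerEquiv.exists_eq_add_smul {d : ℤ} {x y : M} (h : EichlerEquiv B w x y)
    (hx : ∀ z, B z w = 0 → d ∣ B z x) : ∃ a, B a w = 0 ∧ y = x + d • a := by
  induction h with
  | refl => exact ⟨0, by simp, by simp⟩
  | tail _ hstep ih =>
    obtain ⟨c, hcw, rfl⟩ := ih
    obtain ⟨u, a, s, -, -, huw, haw, -, rfl⟩ := hstep
    have hdvd : ∀ z, B z w = 0 → d ∣ B z (x + d • c) := fun z hz => by
      rw [map_add, _root_.map_smul, smul_eq_mul]
      exact dvd_add (hx z hz) (dvd_mul_right _ _)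
    obtain ⟨k, hk⟩ := hdvd u huw
    obtain ⟨l, hl⟩ := hdvd a haw
    refine ⟨c - l • u + k • a - (s * k) • u, ?_, ?_⟩
    · simp [huw, haw, hcw]
    · rw [hk, hl]
      module

variable {u₁ v₁ u₂ v₂ : M}

/-- Two transvections replace the coordinate `b = B(u₁, y)` by `t b - B(c, y)` for a vector `c`
of a second hyperbolic plane. -/
theorem EichlerEquiv.exists_linear_combination (hsymm : ∀ x y, B x y = B y x)
    (h₁ : IsHyperbolicPair B w u₁ v₁) {c c' : M} (hc : IsHyperbolicPair B w c c')
    (huc : B u₁ c = 0) (hvc : B v₁ c = 0) (huc' : B u₁ c' = 0)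
    (y : M) (t : ℤ) :
    ∃ y', EichlerEquiv B w y y' ∧ B u₁ y' = t * B u₁ y - B c y := by
  set y₁ := y - B ((1 - t) • c') y • u₁ + B u₁ y • ((1 - t) • c') - (0 * B u₁ y) • u₁ with hy₁
  have step₁ : IsTransvectionStep B w y y₁ :=
    ⟨u₁, (1 - t) • c', 0, h₁.left_self, by simp [huc'], h₁.left_fixed,
      by simp [hc.right_fixed], by simp [hc.right_self], hy₁⟩
  set y₂ := y₁ - B c y₁ • v₁ + B v₁ y₁ • c - (0 * B v₁ y₁) • v₁ with hy₂
  have step₂ : IsTransvectionStep B w y₁ y₂ :=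
    ⟨v₁, c, 0, h₁.right_self, hvc, h₁.right_fixed, hc.left_fixed, by simp [hc.left_self], hy₂⟩
  refine ⟨y₂, (Relation.ReflTransGen.single step₁).tail step₂, ?_⟩
  have hcu : B c u₁ = 0 := by rw [hsymm, huc]
  simp only [hy₂, hy₁, map_sub, map_add, _root_.map_smul, smul_eq_mul, LinearMap.smul_apply,
    h₁.left_self, h₁.left_right, huc, huc', hcu, hc.left_right]
  ring

/-- A vector of divisibility `d` on `w^⊥` can be moved by transvections to one whose product with
a given isotropic vector of a hyperbolic plane is exactly `d`. -/
theorem EichlerEquiv.exists_pairing_eq (hsymm : ∀ x y, B x y = B y x)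
    (heven : ∀ x, ∃ s, B x x = 2 * s)
    (h₁ : IsHyperbolicPair B w u₁ v₁) (h₂ : IsHyperbolicPair B w u₂ v₂)
    (huu : B u₁ u₂ = 0) (huv : B u₁ v₂ = 0) (hvu : B v₁ u₂ = 0) (hvv : B v₁ v₂ = 0)
    {d : ℤ} {x : M} (hdvd : ∀ z, B z w = 0 → d ∣ B z x) (hd : ∃ z, B z w = 0 ∧ B z x = d) :
    ∃ y, EichlerEquiv B w x y ∧ B u₁ y = d := by
  obtain ⟨m, hattained, hmin⟩ : ∃ m : ℕ, (∃ y, EichlerEquiv B w x y ∧ (B u₁ y).natAbs = m) ∧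
      ∀ y r, EichlerEquiv B w x y → B u₁ y = r → (m = 0 ∨ r.natAbs < m) → r = 0 := by
    by_cases hne : ∃ m : ℕ, m ≠ 0 ∧ ∃ y, EichlerEquiv B w x y ∧ (B u₁ y).natAbs = m
    · classical
      obtain ⟨hm, hy⟩ := Nat.find_spec hne
      refine ⟨Nat.find hne, hy, ?_⟩
      rintro y r hxy rfl (h | h)
      · exact absurd h hm
      · by_contra hr
        exact Nat.find_min hne h ⟨by simpa using hr, y, hxy, rfl⟩
    · push Not at hne
      refine ⟨0, ⟨x, .refl, ?_⟩, ?_⟩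
      · by_contra h
        exact hne _ h x .refl rfl
      · rintro y r hxy rfl -
        by_contra h
        exact hne _ (by simpa using h) y hxy rfl
  have hpair : ∀ {c c'}, IsHyperbolicPair B w c c' → B u₁ c = 0 → B v₁ c = 0 → B u₁ c' = 0 →
      ∀ y, EichlerEquiv B w x y → (B u₁ y).natAbs = m → B u₁ y ∣ B c y := by
    intro c c' hc huc hvc huc' y hxy hy
    obtain ⟨y', hyy', hy'⟩ := exists_linear_combination hsymm h₁ hc huc hvc huc' y
      (B c y / B u₁ y)
    have hr : B u₁ y' = -(B c y % B u₁ y) := by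
      rw [hy', Int.emod_def]
      ring
    have hzero := hmin y' _ (hxy.trans hyy') hr (by
      rcases Nat.eq_zero_or_pos m with h0 | hpos
      · exact .inl h0
      · right
        have hb : B u₁ y ≠ 0 := by omega
        have h1 := Int.emod_nonneg (B c y) hb
        have h2 := Int.emod_lt (B c y) hb
        omega)
    exact Int.dvd_of_emod_eq_zero (by omega)
  obtain ⟨y₀, hxy₀, hy₀⟩ := hattained
  obtain ⟨k, hk⟩ := hpair (h₂.symm hsymm) huv hvv huu y₀ hxy₀ hy₀
  obtain ⟨y, hxy, hy, hvy⟩ : ∃ y, EichlerEquiv B w x y ∧ (B u₁ y).natAbs = m ∧ B v₂ y = 0 := by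
    refine ⟨y₀ - B (-k • u₂) y₀ • u₁ + B u₁ y₀ • (-k • u₂) - (0 * B u₁ y₀) • u₁,
      hxy₀.tail ⟨u₁, -k • u₂, 0, h₁.left_self, by simp [huu], h₁.left_fixed,
        by simp [h₂.left_fixed], by simp [h₂.left_self], rfl⟩, ?_, ?_⟩
    · simpa [h₁.left_self, huu] using hy₀
    · simp [hsymm v₂ u₁, hsymm v₂ u₂, huv, h₂.left_right, hk]
  have huy : B u₁ y ∣ B u₂ y := hpair h₂ huu hvu huv y hxy hy
  have hperp : ∀ a, B u₂ a = 0 → B v₂ a = 0 → B a w = 0 → B u₁ y ∣ B a y := by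
    intro a hua hva haw
    obtain ⟨s, hs⟩ := heven a
    have hstep : IsTransvectionStep B w y
        (y - B a y • v₂ + B v₂ y • a - (s * B v₂ y) • v₂) :=
      ⟨v₂, a, s, h₂.right_self, hva, h₂.right_fixed, haw, hs, rfl⟩
    rw [hvy, zero_smul, mul_zero, zero_smul, add_zero, sub_zero] at hstep
    have hb : B u₁ (y - B a y • v₂) = B u₁ y := by simp [huv]
    have := hpair h₂ huu hvu huv _ (hxy.tail hstep) (by rw [hb, hy])
    rw [hb, map_sub, _root_.map_smul, h₂.left_right, smul_eq_mul, mul_one] at this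
    exact (dvd_sub_right huy).mp this
  have hall : ∀ z, B z w = 0 → B u₁ y ∣ B z y := by
    intro z hz
    have ha := hperp (z - B v₂ z • u₂ - B u₂ z • v₂)
      (by simp [h₂.left_self, h₂.left_right])
      (by simp [h₂.right_self, hsymm v₂ u₂, h₂.left_right])
      (by simp [hz, h₂.left_fixed, h₂.right_fixed])
    simp only [map_sub, _root_.map_smul, LinearMap.sub_apply, LinearMap.smul_apply, smul_eq_mul,
      hvy, mul_zero, sub_zero] at ha
    exact (dvd_sub_left (huy.mul_left _)).mp ha
  obtain ⟨γ, hγ, hγw, hγx⟩ := hxy.exists_isometry hsymm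
  have hbd : B u₁ y ∣ d := by
    obtain ⟨z, hzw, hzx⟩ := hd
    rw [← hzx, ← hγ z x, hγx]
    exact hall _ (by rw [← hγw, hγ, hzw])
  have hdb : d ∣ B u₁ y := by
    obtain ⟨a, -, rfl⟩ := hxy.exists_eq_add_smul hdvd
    rw [map_add, _root_.map_smul, smul_eq_mul]
    exact dvd_add (hdvd _ h₁.left_fixed) (dvd_mul_right _ _)
  rcases Int.natAbs_eq_natAbs_iff.mp
    (Nat.dvd_antisymm (Int.natAbs_dvd_natAbs.mpr hbd) (Int.natAbs_dvd_natAbs.mpr hdb)) with h | h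
  · exact ⟨y, hxy, h⟩
  · obtain ⟨j, hj⟩ := huy
    obtain ⟨y', hyy', hy'⟩ := exists_linear_combination hsymm h₁ h₂ huu hvu huv y (j - 1)
    refine ⟨y', hxy.trans hyy', ?_⟩
    rw [hy', hj, h]
    ring

/-- Eichler's criterion: in an even lattice, two vectors of `w^⊥`-divisibility `d ≠ 0`, of the same
square and congruent modulo `d w^⊥` are exchanged by an isometry fixing `w`, provided that `w^⊥`
contains two orthogonal hyperbolic planes. -/
theorem exists_isometry_of_eichler (hsymm : ∀ x y, B x y = B y x)
    (heven : ∀ x, ∃ s, B x x = 2 * s)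
    (h₁ : IsHyperbolicPair B w u₁ v₁) (h₂ : IsHyperbolicPair B w u₂ v₂)
    (huu : B u₁ u₂ = 0) (huv : B u₁ v₂ = 0) (hvu : B v₁ u₂ = 0) (hvv : B v₁ v₂ = 0)
    {d : ℤ} (hd0 : d ≠ 0) {x x' a : M}
    (hdvd : ∀ z, B z w = 0 → d ∣ B z x) (hd : ∃ z, B z w = 0 ∧ B z x = d)
    (hdvd' : ∀ z, B z w = 0 → d ∣ B z x') (hd' : ∃ z, B z w = 0 ∧ B z x' = d)
    (hsq : B x x = B x' x') (haw : B a w = 0) (ha : x' = x + d • a) :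
    ∃ γ : M ≃ₗ[ℤ] M, (∀ p q, B (γ p) (γ q) = B p q) ∧ γ w = w ∧ γ x = x' := by
  obtain ⟨y, hxy, hy⟩ :=
    EichlerEquiv.exists_pairing_eq hsymm heven h₁ h₂ huu huv hvu hvv hdvd hd
  obtain ⟨y', hxy', hy'⟩ :=
    EichlerEquiv.exists_pairing_eq hsymm heven h₁ h₂ huu huv hvu hvv hdvd' hd'
  obtain ⟨b, hbw, hb⟩ := hxy.exists_eq_add_smul hdvd
  obtain ⟨b', hbw', hb'⟩ := hxy'.exists_eq_add_smul hdvd'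
  obtain ⟨γ, hγ, hγw, hγx⟩ := hxy.exists_isometry hsymm
  obtain ⟨γ', hγ', hγw', hγx'⟩ := hxy'.exists_isometry hsymm
  set c := a + b' - b with hc
  have hyy' : y' = y + d • c := by
    rw [hb', hb, ha, hc]
    module
  have hcw : B c w = 0 := by simp [hc, haw, hbw, hbw']
  have huc : B u₁ c = 0 := by
    have : d * B u₁ c = 0 := by
      have := congrArg (B u₁) hyy'
      simp only [map_add, _root_.map_smul, smul_eq_mul, hy, hy'] at this
      linarith
    exact (mul_eq_zero.mp this).resolve_left hd0
  obtain ⟨s, hs⟩ := heven c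
  have hsq' : B y y = B y' y' := by rw [← hγx, ← hγx', hγ, hγ', hsq]
  have hcoef : B c y + s * d = 0 := by
    have : 2 * d * (B c y + s * d) = 0 := by
      rw [hyy'] at hsq'
      simp only [map_add, _root_.map_smul, LinearMap.add_apply, LinearMap.smul_apply, smul_eq_mul,
        hs, hsymm y c] at hsq'
      linarith
    exact (mul_eq_zero.mp this).resolve_left (mul_ne_zero two_ne_zero hd0)
  have hstep : IsTransvectionStep B w y y' := by
    refine ⟨u₁, c, s, h₁.left_self, huc, h₁.left_fixed, hcw, hs, ?_⟩
    rw [hy, hyy', show B c y = -(s * d) by linarith]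
    module
  obtain ⟨τ, hτ, hτw, hτy⟩ := hstep.exists_isometry hsymm
  refine ⟨(γ.trans τ).trans γ'.symm, fun p q => ?_, ?_, ?_⟩
  · rw [← hγ']
    simp [hτ, hγ]
  · simp [hγw, hτw, LinearEquiv.symm_apply_eq, hγw']
  · simp [hγx, hτy, LinearEquiv.symm_apply_eq, hγx']

end Eichler

theorem gramBilin_UGram (x y : Fin 2 → ℤ) :
    gramBilin UGram x y = x 0 * y 1 + x 1 * y 0 := by
  simp [gramBilin, UGram, Matrix.toLinearMap₂'_apply, Fin.sum_univ_two]

theorem gramBilin_rankOneGram (k : ℤ) (x y : Fin 1 → ℤ) :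
    gramBilin (rankOneGram k) x y = k * (x 0 * y 0) := by
  simp [gramBilin, rankOneGram, Matrix.toLinearMap₂'_apply]
  ring

theorem gramBilin_E8Gram (x y : Fin 8 → ℤ) :
    gramBilin E8Gram x y =
      -2 * (x 0 * y 0 + x 1 * y 1 + x 2 * y 2 + x 3 * y 3 + x 4 * y 4 + x 5 * y 5 + x 6 * y 6 +
        x 7 * y 7) + (x 0 * y 2 + x 2 * y 0) + (x 1 * y 3 + x 3 * y 1) + (x 2 * y 3 + x 3 * y 2) +
        (x 3 * y 4 + x 4 * y 3) + (x 4 * y 5 + x 5 * y 4) + (x 5 * y 6 + x 6 * y 5) +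
        (x 6 * y 7 + x 7 * y 6) := by
  simp [gramBilin, E8Gram, CartanMatrix.E₈, Matrix.toLinearMap₂'_apply, Fin.sum_univ_eight]
  ring

theorem prodBilin_apply {M N : Type*} [AddCommGroup M] [AddCommGroup N] [Module ℤ M] [Module ℤ N]
    (BM : M →ₗ[ℤ] M →ₗ[ℤ] ℤ) (BN : N →ₗ[ℤ] N →ₗ[ℤ] ℤ) (x y : M × N) :
    prodBilin BM BN x y = BM x.1 y.1 + BN x.2 y.2 := rfl

theorem LambdaB_symm (x y : LambdaM) : LambdaB x y = LambdaB y x := by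
  simp only [LambdaB, prodBilin_apply, gramBilin_UGram, gramBilin_E8Gram, gramBilin_rankOneGram]
  ring

theorem LambdaB_even (x : LambdaM) : ∃ s, LambdaB x x = 2 * s := by
  obtain ⟨p, q, r, a, b, c⟩ := x
  refine ⟨p 0 * p 1 + q 0 * q 1 + r 0 * r 1 +
    (-(a 0 ^ 2 + a 1 ^ 2 + a 2 ^ 2 + a 3 ^ 2 + a 4 ^ 2 + a 5 ^ 2 + a 6 ^ 2 + a 7 ^ 2) + a 0 * a 2 +
      a 1 * a 3 + a 2 * a 3 + a 3 * a 4 + a 4 * a 5 + a 5 * a 6 + a 6 * a 7) +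
    (-(b 0 ^ 2 + b 1 ^ 2 + b 2 ^ 2 + b 3 ^ 2 + b 4 ^ 2 + b 5 ^ 2 + b 6 ^ 2 + b 7 ^ 2) + b 0 * b 2 +
      b 1 * b 3 + b 2 * b 3 + b 3 * b 4 + b 4 * b 5 + b 5 * b 6 + b 6 * b 7) - c 0 ^ 2, ?_⟩
  simp only [LambdaB, prodBilin_apply, gramBilin_UGram, gramBilin_E8Gram, gramBilin_rankOneGram]
  ring

/-- The generator of the summand `⟨-2⟩` of `Λ`. -/
def lambdaDelta : LambdaM := (0, 0, 0, 0, 0, 1)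

theorem lambdaDelta_sq : LambdaB lambdaDelta lambdaDelta = -2 := by
  simp [lambdaDelta, LambdaB, prodBilin_apply, gramBilin_rankOneGram]

theorem two_dvd_of_two_dvd_gramBilin_UGram {p : Fin 2 → ℤ} (h : ∀ z, 2 ∣ gramBilin UGram z p)
    (i : Fin 2) : 2 ∣ p i := by
  have h0 := h ![1, 0]
  have h1 := h ![0, 1]
  simp [gramBilin_UGram] at h0 h1
  fin_cases i
  · exact h1
  · exact h0

theorem two_dvd_of_two_dvd_gramBilin_E8Gram {p : Fin 8 → ℤ} (h : ∀ z, 2 ∣ gramBilin E8Gram z p)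
    (i : Fin 8) : 2 ∣ p i := by
  have h0 := h ![1, 0, 0, 0, 0, 0, 0, 0]
  have h1 := h ![0, 1, 0, 0, 0, 0, 0, 0]
  have h2 := h ![0, 0, 1, 0, 0, 0, 0, 0]
  have h3 := h ![0, 0, 0, 1, 0, 0, 0, 0]
  have h4 := h ![0, 0, 0, 0, 1, 0, 0, 0]
  have h5 := h ![0, 0, 0, 0, 0, 1, 0, 0]
  have h6 := h ![0, 0, 0, 0, 0, 0, 1, 0]
  have h7 := h ![0, 0, 0, 0, 0, 0, 0, 1]
  simp [gramBilin_E8Gram] at h0 h1 h2 h3 h4 h5 h6 h7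
  fin_cases i <;> simp <;> omega

/-- The orthogonal complement `U³ ⊕ E8²` of the summand `⟨-2⟩` is unimodular at the prime `2`. -/
theorem exists_eq_smul_lambdaDelta_add {x : LambdaM}
    (h : ∀ z, LambdaB z lambdaDelta = 0 → 2 ∣ LambdaB z x) :
    ∃ (c : ℤ) (a : LambdaM), LambdaB a lambdaDelta = 0 ∧
      x = c • lambdaDelta + (2 : ℤ) • a := by
  obtain ⟨p, q, r, a, b, c⟩ := x
  have half : ∀ {n : ℕ} {f : Fin n → ℤ}, (∀ i, 2 ∣ f i) → ∃ f' : Fin n → ℤ, f = (2 : ℤ) • f' := by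
    intro n f hf
    choose f' hf' using hf
    exact ⟨f', funext fun i => by simp [hf']⟩
  have hp := half (two_dvd_of_two_dvd_gramBilin_UGram fun z => by
    simpa [LambdaB, prodBilin_apply] using
      h (z, 0, 0, 0, 0, 0) (by simp [LambdaB, prodBilin_apply, lambdaDelta]))
  have hq := half (two_dvd_of_two_dvd_gramBilin_UGram fun z => by
    simpa [LambdaB, prodBilin_apply] using
      h (0, z, 0, 0, 0, 0) (by simp [LambdaB, prodBilin_apply, lambdaDelta]))
  have hr := half (two_dvd_of_two_dvd_gramBilin_UGram fun z => by
    simpa [LambdaB, prodBilin_apply] using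
      h (0, 0, z, 0, 0, 0) (by simp [LambdaB, prodBilin_apply, lambdaDelta]))
  have ha := half (two_dvd_of_two_dvd_gramBilin_E8Gram fun z => by
    simpa [LambdaB, prodBilin_apply] using
      h (0, 0, 0, z, 0, 0) (by simp [LambdaB, prodBilin_apply, lambdaDelta]))
  have hb := half (two_dvd_of_two_dvd_gramBilin_E8Gram fun z => by
    simpa [LambdaB, prodBilin_apply] using
      h (0, 0, 0, 0, z, 0) (by simp [LambdaB, prodBilin_apply, lambdaDelta]))
  obtain ⟨p, rfl⟩ := hp
  obtain ⟨q, rfl⟩ := hq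
  obtain ⟨r, rfl⟩ := hr
  obtain ⟨a, rfl⟩ := ha
  obtain ⟨b, rfl⟩ := hb
  refine ⟨c 0, (p, q, r, a, b, 0), by simp [LambdaB, prodBilin_apply, lambdaDelta], ?_⟩
  have hc : c = c 0 • 1 := funext fun i => by simp [Subsingleton.elim i 0]
  simpa [lambdaDelta] using hc

/-- Eichler's criterion in `Λ`, relative to a vector `w` orthogonal to the first two hyperbolic
planes. -/
theorem exists_lambda_isometry {w : LambdaM} (hw₁ : w.1 = 0) (hw₂ : w.2.1 = 0) {d : ℤ}
    (hd0 : d ≠ 0) {x x' a : LambdaM}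
    (hdvd : ∀ z, LambdaB z w = 0 → d ∣ LambdaB z x) (hd : ∃ z, LambdaB z w = 0 ∧ LambdaB z x = d)
    (hdvd' : ∀ z, LambdaB z w = 0 → d ∣ LambdaB z x')
    (hd' : ∃ z, LambdaB z w = 0 ∧ LambdaB z x' = d)
    (hsq : LambdaB x x = LambdaB x' x') (haw : LambdaB a w = 0) (ha : x' = x + d • a) :
    ∃ γ : LambdaM ≃ₗ[ℤ] LambdaM, IsIsometry γ ∧ γ w = w ∧ γ x = x' := by
  refine exists_isometry_of_eichler (B := LambdaB)
    (u₁ := (![1, 0], 0, 0, 0, 0, 0)) (v₁ := (![0, 1], 0, 0, 0, 0, 0))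
    (u₂ := (0, ![1, 0], 0, 0, 0, 0)) (v₂ := (0, ![0, 1], 0, 0, 0, 0))
    LambdaB_symm LambdaB_even ⟨?_, ?_, ?_, ?_, ?_⟩ ⟨?_, ?_, ?_, ?_, ?_⟩ ?_ ?_ ?_ ?_
    hd0 hdvd hd hdvd' hd' hsq haw ha <;>
  simp [LambdaB, prodBilin_apply, gramBilin_UGram, hw₁, hw₂]

/-- A vector of square `-2` and divisibility `2` can be moved to the generator of `⟨-2⟩`. -/
theorem exists_isometry_to_lambdaDelta {g : LambdaM} (hgsq : LambdaB g g = -2)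
    (hdiv : HasDivisibility g 2) :
    ∃ γ : LambdaM ≃ₗ[ℤ] LambdaM, IsIsometry γ ∧ γ g = lambdaDelta := by
  have hg : ∀ z, 2 ∣ LambdaB z g := fun z => LambdaB_symm z g ▸ hdiv.2.1 z
  obtain ⟨c, a, ha, hga⟩ := exists_eq_smul_lambdaDelta_add fun z _ => hg z
  obtain ⟨k, hk⟩ : ∃ k, c = 2 * k + 1 := by
    obtain ⟨s, hs⟩ := LambdaB_even a
    have hsq := hgsq
    simp only [hga, map_add, _root_.map_smul, LinearMap.add_apply, LinearMap.smul_apply,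
      smul_eq_mul, lambdaDelta_sq, ha, LambdaB_symm lambdaDelta a, hs] at hsq
    rcases Int.even_or_odd' c with ⟨k, rfl | rfl⟩
    · have : 4 * (s - k * k) = -1 := by linarith
      omega
    · exact ⟨k, rfl⟩
  obtain ⟨γ, hγ, -, hγg⟩ := exists_lambda_isometry (w := 0) rfl rfl two_ne_zero (x := g)
    (x' := lambdaDelta) (a := -k • lambdaDelta - a) (fun z _ => hg z)
    (by
      obtain ⟨z, hz⟩ := hdiv.2.2
      exact ⟨z, by simp, LambdaB_symm z g ▸ hz⟩)
    (fun z _ => by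
      simp [lambdaDelta, LambdaB, prodBilin_apply, gramBilin_rankOneGram])
    ⟨-lambdaDelta, by simp, by simp [lambdaDelta_sq]⟩
    (by rw [hgsq, lambdaDelta_sq]) (by simp)
    (by
      rw [hga, hk]
      module)
  exact ⟨γ, hγ, hγg⟩

/-- Vectors of square `2` orthogonal to `lambdaDelta` pair to `1` with a vector orthogonal to
`lambdaDelta`. -/
theorem exists_pairing_eq_one {e : LambdaM} (hesq : LambdaB e e = 2)
    (he : LambdaB e lambdaDelta = 0) : ∃ z, LambdaB z lambdaDelta = 0 ∧ LambdaB z e = 1 := by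
  by_cases h : ∀ z, LambdaB z lambdaDelta = 0 → 2 ∣ LambdaB z e
  · obtain ⟨c, a, ha, hea⟩ := exists_eq_smul_lambdaDelta_add h
    obtain ⟨s, hs⟩ := LambdaB_even a
    have hc : c = 0 := by
      simpa [hea, lambdaDelta_sq, ha, -zsmul_eq_mul] using he
    simp [hea, hc, hs, -zsmul_eq_mul] at hesq
    omega
  · push Not at h
    obtain ⟨z, hz, hze⟩ := h
    obtain ⟨k, hk⟩ : ∃ k, LambdaB z e = 2 * k + 1 := by
      rcases Int.even_or_odd' (LambdaB z e) with ⟨k, hk | hk⟩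
      · exact absurd ⟨k, hk⟩ hze
      · exact ⟨k, hk⟩
    exact ⟨z - k • e, by simp [hz, he, -zsmul_eq_mul],
      by simp [hk, hesq, -zsmul_eq_mul]; ring⟩

/-- The isometries fixing `lambdaDelta` act transitively on the vectors of square `2` in its
orthogonal complement. -/
theorem exists_isometry_fixing_lambdaDelta {e e' : LambdaM} (hesq : LambdaB e e = 2)
    (hesq' : LambdaB e' e' = 2) (he : LambdaB e lambdaDelta = 0)
    (he' : LambdaB e' lambdaDelta = 0) :
    ∃ γ : LambdaM ≃ₗ[ℤ] LambdaM, IsIsometry γ ∧ γ lambdaDelta = lambdaDelta ∧ γ e = e' :=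
  exists_lambda_isometry (d := 1) (a := e' - e) rfl rfl one_ne_zero (fun _ _ => one_dvd _)
    (exists_pairing_eq_one hesq he) (fun _ _ => one_dvd _) (exists_pairing_eq_one hesq' he')
    (by rw [hesq, hesq']) (by simp [he, he']) (by module)

/-- An involution with invariant lattice `⟨2⟩ ⊕ ⟨-2⟩` is determined by generators of the two
summands. -/
theorem exists_involution_formula {ι : LambdaM ≃ₗ[ℤ] LambdaM} (hisom : IsIsometry ι)
    (hinvol : ∀ x, ι (ι x) = x) (hK : IsometricTo (invLattice ι) (gramBilin diag2Gram))
    {g : LambdaM} (hg : g ∈ invLattice ι) (hgsq : LambdaB g g = -2) :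
    ∃ e, LambdaB e e = 2 ∧ LambdaB e g = 0 ∧
      ∀ x, ι x = LambdaB x e • e - LambdaB x g • g - x := by
  obtain ⟨φ, hφ⟩ := hK
  obtain ⟨g, rfl⟩ : ∃ g₀ : invLattice ι, (g₀ : LambdaM) = g := ⟨⟨g, hg⟩, rfl⟩
  have hform : ∀ p q : Fin 2 → ℤ, gramBilin diag2Gram p q = 2 * (p 0 * q 0) - 2 * (p 1 * q 1) := by
    intro p q
    simp [gramBilin, diag2Gram, Matrix.toLinearMap₂'_apply, Fin.sum_univ_two]
    ring
  have hmem : ∀ x, x ∈ invLattice ι ↔ ι x = x := fun x => Iff.rfl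
  set e : invLattice ι := φ.symm ![1, 0] with he
  have hφe : φ e = ![1, 0] := by simp [he]
  have hgcoord : φ g 0 = 0 ∧ φ g 1 * φ g 1 = 1 := by
    have h := hφ g g
    rw [hform, hgsq] at h
    generalize φ g 0 = a at h ⊢
    generalize φ g 1 = b at h ⊢
    have hfac : (b - a) * (b + a) = 1 := by linarith
    have ha : a = 0 := by
      rcases Int.eq_one_or_neg_one_of_mul_eq_one' hfac with h | h <;> omega
    subst ha
    exact ⟨rfl, by linarith⟩
  have hdecomp : ∀ y : invLattice ι,
      (2 : ℤ) • (y : LambdaM) = LambdaB y e • (e : LambdaM) - LambdaB y g • (g : LambdaM) := by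
    intro y
    have h : (2 : ℤ) • y = LambdaB y e • e - LambdaB y g • g := by
      apply φ.injective
      have hye := hφ y e
      have hyg := hφ y g
      rw [hform] at hye hyg
      ext i
      rw [← hye, ← hyg]
      fin_cases i
      · simp [hφe, hgcoord.1, -zsmul_eq_mul]
      · simp [hφe, hgcoord.1, -zsmul_eq_mul]
        linear_combination -2 * φ y 1 * hgcoord.2
    exact congrArg Subtype.val h
  refine ⟨e, ?_, ?_, fun x => ?_⟩
  · rw [← hφ e e, hform, hφe]
    simp
  · rw [← hφ e g, hform, hφe, hgcoord.1]
    simp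
  · have hy : x + ι x ∈ invLattice ι := by
      rw [hmem, map_add, hinvol, add_comm]
    have hpair : ∀ z ∈ invLattice ι, LambdaB (x + ι x) z = 2 * LambdaB x z := by
      intro z hz
      have : LambdaB (ι x) z = LambdaB x z := by
        rw [← hisom x z, (hmem z).mp hz]
      rw [map_add, LinearMap.add_apply, this]
      ring
    have h := hdecomp ⟨x + ι x, hy⟩
    rw [hpair e e.2, hpair g g.2] at h
    have h2 : (2 : ℤ) • (x + ι x) =
        (2 : ℤ) • (LambdaB x e • (e : LambdaM) - LambdaB x g • (g : LambdaM)) := by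
      rw [h]
      module
    rw [← smul_right_injective LambdaM (two_ne_zero (α := ℤ)) h2]
    abel

/-- Two involutions of `Λ = U³ ⊕ E8² ⊕ ⟨−2⟩` whose invariant sublattices are both
isometric to `⟨2⟩ ⊕ ⟨−2⟩` and whose square `−2` invariant elements both have
divisibility `2` in `Λ` are conjugate in `O(Λ)`. -/
theorem conjugacy_case_div_two
    (ι ι' : LambdaM ≃ₗ[ℤ] LambdaM)
    (hisom : IsIsometry ι) (hinvol : ∀ x, ι (ι x) = x)
    (hisom' : IsIsometry ι') (hinvol' : ∀ x, ι' (ι' x) = x)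
    (hK : IsometricTo (invLattice ι) (gramBilin diag2Gram))
    (hK' : IsometricTo (invLattice ι') (gramBilin diag2Gram))
    (g g' : LambdaM)
    (hg : g ∈ invLattice ι) (hgsq : LambdaB g g = -2)
    (hg' : g' ∈ invLattice ι') (hgsq' : LambdaB g' g' = -2)
    (hdiv : HasDivisibility g 2) (hdiv' : HasDivisibility g' 2) :
    ConjInO ι ι' := by
  obtain ⟨e, hesq, heg, hι⟩ := exists_involution_formula hisom hinvol hK hg hgsq
  obtain ⟨e', hesq', heg', hι'⟩ := exists_involution_formula hisom' hinvol' hK' hg' hgsq'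
  obtain ⟨γ₁, hγ₁, hγ₁g⟩ := exists_isometry_to_lambdaDelta hgsq hdiv
  obtain ⟨γ₂, hγ₂, hγ₂g⟩ := exists_isometry_to_lambdaDelta hgsq' hdiv'
  obtain ⟨τ, hτ, hτδ, hτe⟩ := exists_isometry_fixing_lambdaDelta (e := γ₁ e) (e' := γ₂ e')
    (by rw [hγ₁, hesq]) (by rw [hγ₂, hesq']) (by rw [← hγ₁g, hγ₁, heg])
    (by rw [← hγ₂g, hγ₂, heg'])
  set γ := (γ₁.trans τ).trans γ₂.symm with hγdef
  have hγ : IsIsometry γ := fun x y => by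
    rw [← hγ₂]
    simp [hγdef, hτ _ _, hγ₁ _ _]
  have hγe : γ e = e' := by simp [hγdef, hτe]
  have hγg : γ g = g' := by simp [hγdef, hγ₁g, hτδ, LinearEquiv.symm_apply_eq, hγ₂g]
  refine ⟨γ, hγ, fun x => ?_⟩
  obtain ⟨x, rfl⟩ := γ.surjective x
  rw [LinearEquiv.symm_apply_apply, hι, hι', ← hγe, ← hγg, hγ, hγ]
  simp only [map_sub, _root_.map_smul]
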